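/- arXiv:2210.05819 — 4 statements merged into one kernel-verified Lean document; each statement's English description precedes it below -/
import Mathlib

section
/- Fix integers N ≥ 1 and n ≥ 0 and a real number p ∈ [0,1]. Let K be a Binomial(N,p) random variable, and let C_n denote the number of distinct values among n i.i.d. random variables uniformly distributed on {1,...,N} (with C_0 = 0), taken independent of K. Then E[(K/N)^n] = E[p^{C_n}], with the convention 0^0 = 1. -/
open Finset

theorem superset_sum (N : ℕ) (p : ℝ) (A : Finset (Fin N)) :
    ∑ S : Finset (Fin N), (if A ⊆ S then p ^ S.card * (1 - p) ^ (N - S.card) else 0)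
      = p ^ A.card := by
  have h := Finset.prod_add (fun _ : Fin N => p) (fun i => if i ∈ A then 0 else 1 - p)
    Finset.univ
  have h1 : ∏ i : Fin N, (p + if i ∈ A then 0 else 1 - p) = p ^ A.card := by
    have : ∀ i : Fin N, (p + if i ∈ A then 0 else 1 - p) = if i ∈ A then p else 1 := by
      intro i; split_ifs <;> ring
    simp_rw [this]
    rw [Finset.prod_ite]
    simp
  rw [← h1, h, Finset.powerset_univ]
  refine Finset.sum_congr rfl fun S _ => ?_
  split_ifs with hS
  · have : ∏ i ∈ Finset.univ \ S, (if i ∈ A then 0 else 1 - p)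
        = ∏ i ∈ Finset.univ \ S, (1 - p) := by
      refine Finset.prod_congr rfl fun i hi => ?_
      have hi' : i ∉ S := (Finset.mem_sdiff.1 hi).2
      rw [if_neg (fun hA => hi' (hS hA))]
    rw [this, Finset.prod_const, Finset.prod_const, Finset.card_univ_sdiff, Fintype.card_fin]
  · obtain ⟨a, haA, haS⟩ := Finset.not_subset.1 hS
    have : ∏ i ∈ Finset.univ \ S, (if i ∈ A then 0 else 1 - p) = 0 :=
      Finset.prod_eq_zero (i := a) (by simp [haS]) (by simp [haA])
    rw [this, mul_zero]

theorem count_maps (N n : ℕ) (S : Finset (Fin N)) :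
    ∑ u : Fin n → Fin N, (if Finset.image u Finset.univ ⊆ S then (1 : ℝ) else 0)
      = (S.card : ℝ) ^ n := by
  rw [Finset.sum_boole]
  have : (Finset.univ.filter fun u : Fin n → Fin N => Finset.image u Finset.univ ⊆ S)
      = Fintype.piFinset (fun _ => S) := by
    ext u
    simp [Finset.image_subset_iff]
  rw [this, Fintype.card_piFinset_const]
  push_cast
  rfl

/-- Fix `N ≥ 1`, `n ≥ 0` and `p ∈ [0,1]`. Let `K` be Binomial(N,p) and
let `C_n` be the number of distinct values among `n` i.i.d. uniform random variables on
`{1,...,N}` (independent of `K`). Then `E[(K/N)^n] = E[p^{C_n}]`, with `0^0 = 1`.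
Expectations are written out explicitly: the left side is the binomial expectation, the
right side averages `p^{|image u|}` over all `N^n` functions `u : Fin n → Fin N`. -/
theorem binomial_moment_eq_distinct_count_dual
    (N n : ℕ) (hN : 1 ≤ N) (p : ℝ) (hp0 : 0 ≤ p) (hp1 : p ≤ 1) :
    ∑ k ∈ Finset.range (N + 1),
        (N.choose k : ℝ) * p ^ k * (1 - p) ^ (N - k) * ((k : ℝ) / N) ^ n
      = (1 / (N : ℝ) ^ n) *
          ∑ u : Fin n → Fin N, p ^ (Finset.image u Finset.univ).card := by
  have key : ∑ u : Fin n → Fin N, p ^ (Finset.image u Finset.univ).card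
      = ∑ S : Finset (Fin N), p ^ S.card * (1 - p) ^ (N - S.card) * (S.card : ℝ) ^ n := by
    rw [Finset.sum_congr rfl fun u _ => (superset_sum N p (Finset.image u Finset.univ)).symm,
      Finset.sum_comm]
    refine Finset.sum_congr rfl fun S _ => ?_
    rw [← count_maps N n S, Finset.mul_sum]
    refine Finset.sum_congr rfl fun u _ => ?_
    rw [mul_ite, mul_one, mul_zero]
  have h2 := Finset.sum_powerset_apply_card
    (fun k => p ^ k * (1 - p) ^ (N - k) * (k : ℝ) ^ n) (x := (Finset.univ : Finset (Fin N)))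
  rw [Finset.powerset_univ, Finset.card_univ, Fintype.card_fin] at h2
  rw [key, h2, Finset.mul_sum]
  refine Finset.sum_congr rfl fun k _ => ?_
  rw [nsmul_eq_mul, div_pow]
  ring
end

section
/- Fix integers N ≥ 1, m ≥ 1 and a probability mass function μ on {1,...,m}. Let (X_g)_{g≥0} be the forward frequency chain started at x̄ = (x_1,...,x_m) ∈ E_N^m, and let (B_g)_{g≥0} be the window chain started at n̄ = (n_1,...,n_m) ∈ ℕ^m. Then for every g ≥ 0, E_{x̄}[ ∏_{i=1}^m (X_g^{(i)})^{n_i} ] = E_{n̄}[ ∏_{i=1}^m x_i^{B_g^{(i)}} ], with the convention 0^0 = 1. (Moment duality between the frequency process and the window process of the seed bank model with uniform reproduction.) -/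
open Finset

/-- One step of the forward frequency chain: the new state is
`(K/N, x_1, ..., x_{m-1})` where `K` is the binomial sample. -/
noncomputable def pushVec (N m : ℕ) (x : Fin (m + 1) → ℝ) (k : ℕ) : Fin (m + 1) → ℝ :=
  fun i => if h : (i : ℕ) = 0 then (k : ℝ) / N else x ⟨(i : ℕ) - 1, by omega⟩

/-- Transition operator of the forward frequency chain of the seed bank model with
uniform reproduction: `(freqOp f)(x̄) = E_{x̄}[f(X_1)]`, where one step replaces `x̄` by
`(K/N, x_1, ..., x_{m-1})` with `K ~ Binomial(N, ∑_j μ(j)·x_j)`. -/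
noncomputable def freqOp (N m : ℕ) (μ : Fin (m + 1) → ℝ) (f : (Fin (m + 1) → ℝ) → ℝ)
    (x : Fin (m + 1) → ℝ) : ℝ :=
  ∑ k ∈ Finset.range (N + 1),
    (N.choose k : ℝ) * (∑ j, μ j * x j) ^ k * (1 - ∑ j, μ j * x j) ^ (N - k) *
      f (pushVec N m x k)

/-- The multiplicity counts of a sample `v` of values in `{1,...,m}`:
`counts v i = |{t : v t = i}|`. -/
def counts (m : ℕ) {c : ℕ} (v : Fin c → Fin (m + 1)) : Fin (m + 1) → ℕ :=
  fun i => (Finset.univ.filter (fun t => v t = i)).card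

/-- The deterministic shift of the window chain: from `n̄` and multinomial counts `cnt`,
the new state is `(n_2 + cnt_1, ..., n_m + cnt_{m-1}, cnt_m)`. -/
def winShift (m : ℕ) (nv : Fin (m + 1) → ℕ) (cnt : Fin (m + 1) → ℕ) :
    Fin (m + 1) → ℕ :=
  fun i => (if h : (i : ℕ) + 1 < m + 1 then nv ⟨(i : ℕ) + 1, h⟩ else 0) + cnt i

/-- Transition operator of the window chain: `(winOp f)(n̄) = E_{n̄}[f(B_1)]`. One step:
take `n_1` i.i.d. uniform values on `{1,...,N}` (a uniform `u : Fin n_1 → Fin N`), let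
`C = |image u|` be the number of distinct values, then throw `C` i.i.d. `μ`-samples
(`v : Fin C → Fin m`) and add their counts to the shifted vector. -/
noncomputable def winOp (N m : ℕ) (μ : Fin (m + 1) → ℝ) (f : (Fin (m + 1) → ℕ) → ℝ)
    (nv : Fin (m + 1) → ℕ) : ℝ :=
  (1 / (N : ℝ) ^ (nv 0)) *
    ∑ u : Fin (nv 0) → Fin N,
      ∑ v : Fin ((Finset.image u Finset.univ).card) → Fin (m + 1),
        (∏ t, μ (v t)) * f (winShift m nv (counts m v))

lemma aux_sup (N : ℕ) (p : ℝ) (T : Finset (Fin N)) :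
    ∑ S : Finset (Fin N), (if T ⊆ S then p ^ S.card * (1 - p) ^ (N - S.card) else 0)
      = p ^ T.card := by
  have h := Finset.prod_add (fun _ : Fin N => p) (fun i => if i ∈ T then 0 else (1 - p)) univ
  have h1 : ∏ i : Fin N, (p + if i ∈ T then 0 else (1 - p)) = p ^ T.card := by
    have : ∀ i : Fin N, (p + if i ∈ T then 0 else (1 - p)) = if i ∈ T then p else 1 := by
      intro i; split_ifs <;> ring
    simp only [this]
    rw [Finset.prod_ite]
    simp
  rw [h1] at h
  rw [h, Finset.powerset_univ]
  refine Finset.sum_congr rfl fun S _ => ?_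
  by_cases hTS : T ⊆ S
  · rw [if_pos hTS]
    have h2 : ∏ i ∈ univ \ S, (if i ∈ T then 0 else (1 - p)) = ∏ i ∈ univ \ S, (1 - p) := by
      refine Finset.prod_congr rfl fun i hi => ?_
      rw [if_neg]
      intro hT
      exact (Finset.mem_sdiff.1 hi).2 (hTS hT)
    rw [h2]
    simp [Finset.card_univ_sdiff]
  · rw [if_neg hTS]
    obtain ⟨i, hi, hiS⟩ := Finset.not_subset.1 hTS
    have : ∏ i ∈ univ \ S, (if i ∈ T then 0 else (1 - p)) = 0 :=
      Finset.prod_eq_zero (i := i) (by simp [hiS]) (by simp [hi])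
    rw [this, mul_zero]

lemma aux_card (N n : ℕ) (S : Finset (Fin N)) :
    ((S.card : ℝ)) ^ n = ∑ u : Fin n → Fin N, if Finset.image u univ ⊆ S then (1 : ℝ) else 0 := by
  rw [Finset.sum_boole]
  have : (univ.filter fun u : Fin n → Fin N => Finset.image u univ ⊆ S)
      = Fintype.piFinset (fun _ => S) := by
    ext u
    simp [Fintype.mem_piFinset, Finset.image_subset_iff]
  rw [this]
  simp

lemma aux_binom (N n : ℕ) (p : ℝ) :
    ∑ k ∈ Finset.range (N + 1), (N.choose k : ℝ) * p ^ k * (1 - p) ^ (N - k) * (k : ℝ) ^ n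
      = ∑ u : Fin n → Fin N, p ^ (Finset.image u univ).card := by
  have h := Finset.sum_powerset_apply_card (x := (univ : Finset (Fin N)))
    (fun k => p ^ k * (1 - p) ^ (N - k) * (k : ℝ) ^ n)
  simp only [Finset.card_univ, Fintype.card_fin, nsmul_eq_mul, Finset.powerset_univ] at h
  calc _ = ∑ S : Finset (Fin N), p ^ S.card * (1 - p) ^ (N - S.card) * (S.card : ℝ) ^ n := by
        rw [h]; exact Finset.sum_congr rfl fun k _ => by ring
    _ = ∑ S : Finset (Fin N), ∑ u : Fin n → Fin N,
          (if Finset.image u univ ⊆ S then p ^ S.card * (1 - p) ^ (N - S.card) else 0) := by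
        refine Finset.sum_congr rfl fun S _ => ?_
        rw [aux_card, Finset.mul_sum]
        exact Finset.sum_congr rfl fun u _ => by split_ifs <;> simp
    _ = _ := by
        rw [Finset.sum_comm]
        exact Finset.sum_congr rfl fun u _ => aux_sup N p _

lemma aux_multi (m c : ℕ) (μ x : Fin (m + 1) → ℝ) :
    ∑ v : Fin c → Fin (m + 1), (∏ t, μ (v t)) * ∏ i, x i ^ counts m v i
      = (∑ j, μ j * x j) ^ c := by
  have h1 : ∀ v : Fin c → Fin (m + 1), ∏ i, x i ^ counts m v i = ∏ t, x (v t) := by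
    intro v
    rw [← Finset.prod_fiberwise univ v (fun t => x (v t))]
    refine Finset.prod_congr rfl fun i _ => ?_
    rw [counts, ← Finset.prod_const]
    refine Finset.prod_congr rfl fun t ht => ?_
    rw [(Finset.mem_filter.1 ht).2]
  simp only [h1, ← Finset.prod_mul_distrib]
  rw [← Fintype.piFinset_univ, ← Finset.prod_univ_sum (fun _ => univ) (fun _ j => μ j * x j)]
  simp

lemma aux_push (N m : ℕ) (x : Fin (m + 1) → ℝ) (nv : Fin (m + 1) → ℕ) (k : ℕ) :
    ∏ i, pushVec N m x k i ^ nv i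
      = ((k : ℝ) / N) ^ nv 0 * ∏ i : Fin m, x i.castSucc ^ nv i.succ := by
  rw [Fin.prod_univ_succ]
  rfl

lemma aux_shift (m : ℕ) (x : Fin (m + 1) → ℝ) (nv c : Fin (m + 1) → ℕ) :
    ∏ i, x i ^ winShift m nv c i
      = (∏ i : Fin m, x i.castSucc ^ nv i.succ) * ∏ i, x i ^ c i := by
  simp only [winShift, pow_add, Finset.prod_mul_distrib]
  congr 1
  rw [Fin.prod_univ_castSucc]
  simp [Fin.succ]

lemma aux_step (N m : ℕ) (μ x : Fin (m + 1) → ℝ) (nv : Fin (m + 1) → ℕ) :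
    freqOp N m μ (fun y => ∏ i, y i ^ nv i) x = winOp N m μ (fun b => ∏ i, x i ^ b i) nv := by
  simp only [freqOp, winOp, aux_push, aux_shift]
  set p := ∑ j, μ j * x j with hp
  set R := ∏ i : Fin m, x i.castSucc ^ nv i.succ
  have h1 : ∀ u : Fin (nv 0) → Fin N,
      ∑ v : Fin ((Finset.image u Finset.univ).card) → Fin (m + 1),
        (∏ t, μ (v t)) * (R * ∏ i, x i ^ counts m v i)
      = R * p ^ (Finset.image u univ).card := by
    intro u
    rw [hp, ← aux_multi, Finset.mul_sum]
    exact Finset.sum_congr rfl fun v _ => by ring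
  simp only [h1]
  rw [← Finset.mul_sum, ← aux_binom, Finset.mul_sum, Finset.mul_sum]
  refine Finset.sum_congr rfl fun k _ => ?_
  rw [div_pow]
  ring

lemma aux_comm (N m : ℕ) (μ : Fin (m + 1) → ℝ)
    (h : (Fin (m + 1) → ℝ) → (Fin (m + 1) → ℕ) → ℝ)
    (x : Fin (m + 1) → ℝ) (nv : Fin (m + 1) → ℕ) :
    freqOp N m μ (fun y => winOp N m μ (h y) nv) x
      = winOp N m μ (fun b => freqOp N m μ (fun y => h y b) x) nv := by
  simp only [freqOp, winOp, Finset.mul_sum]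
  rw [Finset.sum_comm]
  refine Finset.sum_congr rfl fun u _ => ?_
  rw [Finset.sum_comm]
  refine Finset.sum_congr rfl fun v _ => ?_
  refine Finset.sum_congr rfl fun k _ => ?_
  ring

lemma aux_comm_iter (N m : ℕ) (μ : Fin (m + 1) → ℝ) (g : ℕ)
    (h : (Fin (m + 1) → ℝ) → (Fin (m + 1) → ℕ) → ℝ)
    (x : Fin (m + 1) → ℝ) (nv : Fin (m + 1) → ℕ) :
    (freqOp N m μ)^[g] (fun y => winOp N m μ (h y) nv) x
      = winOp N m μ (fun b => (freqOp N m μ)^[g] (fun y => h y b) x) nv := by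
  induction g generalizing h with
  | zero => rfl
  | succ g ih =>
    simp only [Function.iterate_succ_apply]
    rw [← ih (fun y b => freqOp N m μ (fun y => h y b) y)]
    refine congrArg (fun F => (freqOp N m μ)^[g] F x) ?_
    funext y
    exact aux_comm N m μ h y nv

/-- Moment duality between the frequency process `(X_g)` and the window
process `(B_g)` of the seed bank model with uniform reproduction: for every `g ≥ 0`,
`E_{x̄}[∏_i (X_g^{(i)})^{n_i}] = E_{n̄}[∏_i x_i^{B_g^{(i)}}]` (convention `0^0 = 1`).
The expectations `E_{x̄}[f(X_g)]` and `E_{n̄}[h(B_g)]` are encoded as `g`-fold iterates of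
the one-step transition operators applied to `f`, resp. `h`. -/
theorem moment_duality_frequency_window
    (N m : ℕ) (hN : 1 ≤ N) (μ : Fin (m + 1) → ℝ)
    (hμ0 : ∀ i, 0 ≤ μ i) (hμ1 : ∑ i, μ i = 1)
    (x : Fin (m + 1) → ℝ) (hx : ∀ i, ∃ k : ℕ, k ≤ N ∧ x i = (k : ℝ) / N)
    (nv : Fin (m + 1) → ℕ) (g : ℕ) :
    (freqOp N m μ)^[g] (fun y => ∏ i, y i ^ nv i) x
      = (winOp N m μ)^[g] (fun b => ∏ i, x i ^ b i) nv := by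
  clear hx hμ0 hμ1 hN
  induction g generalizing nv with
  | zero => rfl
  | succ g ih =>
    rw [Function.iterate_succ_apply, Function.iterate_succ_apply']
    have h1 : freqOp N m μ (fun y => ∏ i, y i ^ nv i)
        = fun y => winOp N m μ (fun b => ∏ i, y i ^ b i) nv := by
      funext y
      exact aux_step N m μ y nv
    rw [h1, aux_comm_iter N m μ g (fun y b => ∏ i, y i ^ b i)]
    congr 1
    funext b
    exact ih b
end

section
/- Fix integers N ≥ 1, m ≥ 1, a probability mass function μ on {1,...,m}, and nonnegative reals u_0, u_1, u_2 with u_0 + u_1 + u_2 = 1 and u_1 + u_2 > 0; set θ = u_2/(u_1+u_2). Let (X_g)_{g≥0} be the forward frequency chain with mutations started at x̄ = (x_1,...,x_m) ∈ E_N^m, and let (B_g, D_g)_{g≥0} be the window chain with mutations started at (n̄, 0) with n̄ ∈ ℕ^m. Then for every g ≥ 0, E_{x̄}[ ∏_{i=1}^m (X_g^{(i)})^{n_i} ] = E_{(n̄,0)}[ θ^{D_g} · ∏_{i=1}^m x_i^{B_g^{(i)}} ], with the convention 0^0 = 1. (Moment duality between the frequency process with mutations and the window process with mutations, for uniform reproduction.)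 -/
open Finset

/-- Transition operator of the forward frequency chain with mutations:
`(freqMutOp f)(x̄) = E_{x̄}[f(X_1)]`, where one step replaces `x̄` by
`(K/N, x_1, ..., x_{m-1})` with `K ~ Binomial(N, u_2 + u_0·∑_j μ(j)·x_j)`. -/
noncomputable def freqMutOp (N m : ℕ) (μ : Fin (m + 1) → ℝ) (u0 u2 : ℝ)
    (f : (Fin (m + 1) → ℝ) → ℝ) (x : Fin (m + 1) → ℝ) : ℝ :=
  ∑ k ∈ Finset.range (N + 1),
    (N.choose k : ℝ) * (u2 + u0 * ∑ j, μ j * x j) ^ k *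
      (1 - (u2 + u0 * ∑ j, μ j * x j)) ^ (N - k) * f (pushVec N m x k)

/-- Transition operator of the window chain with mutations, a Markov chain on
`ℕ^m × ℕ`: `(winMutOp f)(n̄, d) = E_{(n̄,d)}[f(B_1, D_1)]`. One step: take `n_1` i.i.d.
uniforms on `{1,...,N}` (a uniform `u : Fin n_1 → Fin N`), let `C = |image u|`;
given `C`, let `F ~ Binomial(C, u_1+u_2)` (frozen lineages); given `C, F`, throw `C−F`
i.i.d. `μ`-samples `v` and add their counts to the shifted vector; `d` increases by `F`. -/
noncomputable def winMutOp (N m : ℕ) (μ : Fin (m + 1) → ℝ) (u0 u1 u2 : ℝ)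
    (f : ((Fin (m + 1) → ℕ) × ℕ) → ℝ) (s : (Fin (m + 1) → ℕ) × ℕ) : ℝ :=
  (1 / (N : ℝ) ^ (s.1 0)) *
    ∑ u : Fin (s.1 0) → Fin N,
      ∑ fr ∈ Finset.range ((Finset.image u Finset.univ).card + 1),
        ((Finset.image u Finset.univ).card.choose fr : ℝ) * (u1 + u2) ^ fr *
          u0 ^ ((Finset.image u Finset.univ).card - fr) *
          ∑ v : Fin ((Finset.image u Finset.univ).card - fr) → Fin (m + 1),
            (∏ t, μ (v t)) * f (winShift m s.1 (counts m v), s.2 + fr)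

theorem freq_sum (N m : ℕ) (μ : Fin (m + 1) → ℝ) (u0 u2 : ℝ) {ι : Type*} (S : Finset ι)
    (f : ι → (Fin (m + 1) → ℝ) → ℝ) (x : Fin (m + 1) → ℝ) :
    freqMutOp N m μ u0 u2 (fun y => ∑ i ∈ S, f i y) x
      = ∑ i ∈ S, freqMutOp N m μ u0 u2 (fun y => f i y) x := by
  simp only [freqMutOp, Finset.mul_sum]
  rw [Finset.sum_comm]

theorem freq_mul (N m : ℕ) (μ : Fin (m + 1) → ℝ) (u0 u2 : ℝ) (c : ℝ)
    (f : (Fin (m + 1) → ℝ) → ℝ) (x : Fin (m + 1) → ℝ) :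
    freqMutOp N m μ u0 u2 (fun y => c * f y) x
      = c * freqMutOp N m μ u0 u2 (fun y => f y) x := by
  simp only [freqMutOp, Finset.mul_sum]
  exact Finset.sum_congr rfl fun k _ => by ring

theorem freq_win_comm (N m : ℕ) (μ : Fin (m + 1) → ℝ) (u0 u1 u2 : ℝ)
    (h : (Fin (m + 1) → ℝ) → ((Fin (m + 1) → ℕ) × ℕ) → ℝ)
    (x : Fin (m + 1) → ℝ) (s : (Fin (m + 1) → ℕ) × ℕ) :
    freqMutOp N m μ u0 u2 (fun y => winMutOp N m μ u0 u1 u2 (h y) s) x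
      = winMutOp N m μ u0 u1 u2 (fun s => freqMutOp N m μ u0 u2 (fun y => h y s) x) s := by
  simp only [winMutOp, freq_sum, freq_mul]

theorem freq_iter_win_comm (N m : ℕ) (μ : Fin (m + 1) → ℝ) (u0 u1 u2 : ℝ) (g : ℕ)
    (h : (Fin (m + 1) → ℝ) → ((Fin (m + 1) → ℕ) × ℕ) → ℝ)
    (x : Fin (m + 1) → ℝ) (s : (Fin (m + 1) → ℕ) × ℕ) :
    (freqMutOp N m μ u0 u2)^[g] (fun y => winMutOp N m μ u0 u1 u2 (h y) s) x
      = winMutOp N m μ u0 u1 u2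
          (fun s => (freqMutOp N m μ u0 u2)^[g] (fun y => h y s) x) s := by
  induction g generalizing h with
  | zero => rfl
  | succ g ih =>
    simp only [Function.iterate_succ_apply]
    rw [show freqMutOp N m μ u0 u2 (fun y => winMutOp N m μ u0 u1 u2 (h y) s)
      = fun x => winMutOp N m μ u0 u1 u2
          (fun s => freqMutOp N m μ u0 u2 (fun y => h y s) x) s from
        funext fun x => freq_win_comm N m μ u0 u1 u2 h x s]
    exact ih (fun x s => freqMutOp N m μ u0 u2 (fun y => h y s) x)

theorem sum_supersets (N : ℕ) (p : ℝ) (T : Finset (Fin N)) :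
    ∑ A : Finset (Fin N), (if T ⊆ A then p ^ A.card * (1 - p) ^ (N - A.card) else 0)
      = p ^ T.card := by
  have h := Finset.prod_add (fun _ : Fin N => p) (fun i => if i ∈ T then 0 else 1 - p) univ
  have h1 : ∏ i : Fin N, (p + if i ∈ T then 0 else 1 - p) = p ^ T.card := by
    have : ∀ i : Fin N, (p + if i ∈ T then 0 else 1 - p) = if i ∈ T then p else 1 := by
      intro i; split_ifs <;> ring
    simp [this]
  rw [h1, Finset.powerset_univ] at h
  rw [h]
  refine Finset.sum_congr rfl fun A _ => ?_
  rw [Finset.prod_const]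
  split_ifs with hA
  · congr 1
    rw [Finset.prod_congr rfl (g := fun _ => 1 - p), Finset.prod_const]
    · rw [Finset.card_sdiff_of_subset (Finset.subset_univ _)]; simp
    · intro i hi
      rw [if_neg]
      intro hT
      exact (Finset.mem_sdiff.1 hi).2 (hA hT)
  · obtain ⟨i, hi, hiA⟩ := Finset.not_subset.1 hA
    rw [Finset.prod_eq_zero (i := i) (by simp [hiA]) (by simp [hi]), mul_zero]

theorem binom_moment (N n : ℕ) (p : ℝ) :
    ∑ k ∈ Finset.range (N + 1), (N.choose k : ℝ) * p ^ k * (1 - p) ^ (N - k) * (k : ℝ) ^ n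
      = ∑ u : Fin n → Fin N, p ^ (Finset.image u Finset.univ).card := by
  have hcard : ∀ A : Finset (Fin N),
      ((A.card : ℝ)) ^ n = ∑ u : Fin n → Fin N, if Finset.image u univ ⊆ A then (1 : ℝ) else 0 := by
    intro A
    have h := Fintype.sum_pow (fun i : Fin N => if i ∈ A then (1 : ℝ) else 0) n
    rw [Finset.sum_boole] at h
    simp only [Finset.filter_univ_mem] at h
    rw [h]
    refine Finset.sum_congr rfl fun u _ => ?_
    rw [Finset.prod_ite_zero]
    simp [Finset.image_subset_iff]
  have hL := Finset.sum_powerset_apply_card (x := (univ : Finset (Fin N)))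
    (fun k => p ^ k * (1 - p) ^ (N - k) * (k : ℝ) ^ n)
  rw [Finset.card_univ, Fintype.card_fin, Finset.powerset_univ] at hL
  calc _ = ∑ A : Finset (Fin N), p ^ A.card * (1 - p) ^ (N - A.card) * (A.card : ℝ) ^ n := by
        rw [hL]
        exact Finset.sum_congr rfl fun k _ => by rw [nsmul_eq_mul]; ring
    _ = ∑ A : Finset (Fin N), ∑ u : Fin n → Fin N,
          if Finset.image u univ ⊆ A then p ^ A.card * (1 - p) ^ (N - A.card) else 0 := by
        refine Finset.sum_congr rfl fun A _ => ?_
        rw [hcard, Finset.mul_sum]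
        exact Finset.sum_congr rfl fun u _ => by rw [mul_ite, mul_one, mul_zero]
    _ = _ := by
        rw [Finset.sum_comm]
        exact Finset.sum_congr rfl fun u _ => sum_supersets N p _

theorem prod_winShift (m : ℕ) (x : Fin (m + 1) → ℝ) (nv : Fin (m + 1) → ℕ) {c : ℕ}
    (v : Fin c → Fin (m + 1)) :
    ∏ i, x i ^ winShift m nv (counts m v) i
      = (∏ i : Fin m, x i.castSucc ^ nv i.succ) * ∏ t, x (v t) := by
  simp only [winShift, pow_add, Finset.prod_mul_distrib]
  congr 1
  · rw [Fin.prod_univ_castSucc]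
    simp [Fin.succ]
  · simp only [counts]
    rw [← Finset.prod_fiberwise' univ v x]
    simp

theorem one_step (N m : ℕ) (μ : Fin (m + 1) → ℝ) (u0 u1 u2 : ℝ) (hupos : 0 < u1 + u2)
    (x : Fin (m + 1) → ℝ) (s : (Fin (m + 1) → ℕ) × ℕ) :
    freqMutOp N m μ u0 u2 (fun y => (u2 / (u1 + u2)) ^ s.2 * ∏ i, y i ^ s.1 i) x
      = winMutOp N m μ u0 u1 u2
          (fun s => (u2 / (u1 + u2)) ^ s.2 * ∏ i, x i ^ s.1 i) s := by
  obtain ⟨nv, d⟩ := s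
  set θ := u2 / (u1 + u2) with hθ
  have hθ' : (u1 + u2) * θ = u2 := by rw [hθ]; field_simp
  set S := ∑ j, μ j * x j with hS
  set R := ∏ i : Fin m, x i.castSucc ^ nv i.succ with hR
  have hL : freqMutOp N m μ u0 u2 (fun y => θ ^ d * ∏ i, y i ^ nv i) x
      = θ ^ d * R * (1 / (N : ℝ) ^ nv 0) *
        ∑ u : Fin (nv 0) → Fin N, (u2 + u0 * S) ^ (Finset.image u Finset.univ).card := by
    rw [← binom_moment, Finset.mul_sum]
    unfold freqMutOp
    refine Finset.sum_congr rfl fun k _ => ?_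
    have : ∏ i, pushVec N m x k i ^ nv i = ((k : ℝ) / N) ^ nv 0 * R := by
      rw [Fin.prod_univ_succ]
      simp [pushVec, hR, Fin.castSucc, Fin.castAdd, Fin.castLE]
    beta_reduce
    rw [this, div_pow, ← hS]
    ring
  rw [hL]
  simp only [winMutOp]
  rw [mul_comm (θ ^ d * R), mul_assoc, Finset.mul_sum]
  congr 1
  refine Finset.sum_congr rfl fun u _ => ?_
  generalize (Finset.image u Finset.univ).card = c
  rw [add_pow, Finset.mul_sum]
  refine Finset.sum_congr rfl fun fr _ => ?_
  have : ∑ v : Fin (c - fr) → Fin (m + 1),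
      (∏ t, μ (v t)) * (θ ^ (d + fr) * ∏ i, x i ^ winShift m nv (counts m v) i)
      = θ ^ (d + fr) * R * S ^ (c - fr) := by
    rw [hS, Fintype.sum_pow, Finset.mul_sum]
    refine Finset.sum_congr rfl fun v _ => ?_
    rw [prod_winShift, Finset.prod_mul_distrib]
    ring
  rw [this, ← hθ', mul_pow, mul_pow, pow_add]
  rw [hθ']
  ring

/-- Moment duality between the frequency process with mutations
`(X_g)` and the window process with mutations `(B_g, D_g)`, for uniform reproduction:
with `θ = u_2/(u_1+u_2)`, for every `g ≥ 0`,
`E_{x̄}[∏_i (X_g^{(i)})^{n_i}] = E_{(n̄,0)}[θ^{D_g} ∏_i x_i^{B_g^{(i)}}]`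
(convention `0^0 = 1`). Expectations of functions of the chains at time `g` are encoded
as `g`-fold iterates of the one-step transition operators. -/
theorem moment_duality_frequency_window_mutation
    (N m : ℕ) (hN : 1 ≤ N) (μ : Fin (m + 1) → ℝ)
    (hμ0 : ∀ i, 0 ≤ μ i) (hμ1 : ∑ i, μ i = 1)
    (u0 u1 u2 : ℝ) (hu0 : 0 ≤ u0) (hu1 : 0 ≤ u1) (hu2 : 0 ≤ u2)
    (husum : u0 + u1 + u2 = 1) (hupos : 0 < u1 + u2)
    (x : Fin (m + 1) → ℝ) (hx : ∀ i, ∃ k : ℕ, k ≤ N ∧ x i = (k : ℝ) / N)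
    (nv : Fin (m + 1) → ℕ) (g : ℕ) :
    (freqMutOp N m μ u0 u2)^[g] (fun y => ∏ i, y i ^ nv i) x
      = (winMutOp N m μ u0 u1 u2)^[g]
          (fun s => (u2 / (u1 + u2)) ^ s.2 * ∏ i, x i ^ s.1 i) (nv, 0) := by
  have key : ∀ s : (Fin (m + 1) → ℕ) × ℕ,
      (freqMutOp N m μ u0 u2)^[g] (fun y => (u2 / (u1 + u2)) ^ s.2 * ∏ i, y i ^ s.1 i) x
      = (winMutOp N m μ u0 u1 u2)^[g]
          (fun s => (u2 / (u1 + u2)) ^ s.2 * ∏ i, x i ^ s.1 i) s := by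
    clear hx
    induction g with
    | zero => intro s; rfl
    | succ g ih =>
      intro s
      rw [Function.iterate_succ_apply, Function.iterate_succ_apply', ← funext ih,
        ← freq_iter_win_comm]
      refine congrFun (congrArg _ ?_) x
      exact funext fun y => one_step N m μ u0 u1 u2 hupos y s
  simpa using key (nv, 0)
end

section
/- Fix integers N ≥ 1, m ≥ 1 and a probability mass function μ on {1,...,m} with mean β = ∑_{i=1}^m i·μ(i), and set ν(i) = (∑_{j=i}^m μ(j))/β for 1 ≤ i ≤ m. Let (X_g)_{g≥0} be the forward frequency chain started at x̄ = (x_1,...,x_m) ∈ E_N^m. Then the quantity ∑_{i=1}^m ν(i)·X_g^{(i)} has constant expectation: for every g ≥ 0, E_{x̄}[ ∑_{i=1}^m ν(i)·X_g^{(i)} ] = ∑_{i=1}^m ν(i)·x_i. (The stationarity-weighted total frequency x_0 = ∑_i ν(i)x_i is conserved in expectation by the seed bank frequency process.) -/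
open Finset

/-- The stationary weights of the associated renewal chain: `ν(i) = (∑_{j=i}^m μ(j))/β`
with `β = ∑_{j=1}^m j·μ(j)`; here index `i : Fin m` (0-based) stands for the value
`i+1 ∈ {1,...,m}`. -/
noncomputable def nuW (m : ℕ) (μ : Fin (m + 1) → ℝ) (i : Fin (m + 1)) : ℝ :=
  (∑ j, if i ≤ j then μ j else 0) / ∑ j : Fin (m + 1), ((j.val + 1 : ℕ) : ℝ) * μ j

theorem binom_affine (N : ℕ) (hN : 1 ≤ N) (p a b : ℝ) :
    ∑ k ∈ Finset.range (N + 1),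
      (N.choose k : ℝ) * p ^ k * (1 - p) ^ (N - k) * (a * ((k : ℝ) / N) + b) = a * p + b := by
  have h0 := congrArg (Polynomial.eval p) (bernsteinPolynomial.sum ℝ N)
  have h1 := congrArg (Polynomial.eval p) (bernsteinPolynomial.sum_smul ℝ N)
  simp only [Polynomial.eval_finsetSum, bernsteinPolynomial, Polynomial.eval_mul,
    Polynomial.eval_pow, Polynomial.eval_sub, Polynomial.eval_one, Polynomial.eval_X,
    Polynomial.eval_natCast, nsmul_eq_mul] at h0 h1
  have hN' : (N : ℝ) ≠ 0 := by positivity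
  calc _ = a / N * (∑ k ∈ Finset.range (N + 1),
              (k : ℝ) * ((N.choose k : ℝ) * p ^ k * (1 - p) ^ (N - k)))
            + b * ∑ k ∈ Finset.range (N + 1), (N.choose k : ℝ) * p ^ k * (1 - p) ^ (N - k) := by
          rw [Finset.mul_sum, Finset.mul_sum, ← Finset.sum_add_distrib]
          refine Finset.sum_congr rfl fun k _ => ?_
          ring
    _ = _ := by
          rw [h0, h1]
          field_simp

theorem nuW_zero (m : ℕ) (μ : Fin (m + 1) → ℝ) (hμ1 : ∑ i, μ i = 1) :
    nuW m μ 0 = 1 / ∑ j : Fin (m + 1), ((j.val + 1 : ℕ) : ℝ) * μ j := by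
  simp only [nuW, Fin.zero_le, if_true, hμ1]

theorem nuW_last (m : ℕ) (μ : Fin (m + 1) → ℝ) :
    nuW m μ (Fin.last m) = μ (Fin.last m) / ∑ j : Fin (m + 1), ((j.val + 1 : ℕ) : ℝ) * μ j := by
  simp only [nuW, Fin.last_le_iff, Finset.sum_ite_eq', Finset.mem_univ, if_true]

theorem nuW_castSucc (m : ℕ) (μ : Fin (m + 1) → ℝ) (i : Fin m) :
    nuW m μ i.castSucc = μ i.castSucc / (∑ j : Fin (m + 1), ((j.val + 1 : ℕ) : ℝ) * μ j)
      + nuW m μ i.succ := by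
  unfold nuW
  rw [← add_div]
  congr 1
  have : μ i.castSucc = ∑ j, if j = i.castSucc then μ j else 0 := by simp
  rw [this, ← Finset.sum_add_distrib]
  refine Finset.sum_congr rfl fun j _ => ?_
  simp only [Fin.le_def, Fin.ext_iff, Fin.val_castSucc, Fin.val_succ]
  split_ifs <;> first | omega | simp

theorem freqOp_fixed (N m : ℕ) (hN : 1 ≤ N) (μ : Fin (m + 1) → ℝ) (hμ1 : ∑ i, μ i = 1) :
    freqOp N m μ (fun y => ∑ i, nuW m μ i * y i) = fun y => ∑ i, nuW m μ i * y i := by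
  funext x
  have hp : ∀ k : ℕ, ∑ i, nuW m μ i * pushVec N m x k i
      = nuW m μ 0 * ((k : ℝ) / N) + ∑ i : Fin m, nuW m μ i.succ * x i.castSucc := by
    intro k
    rw [Fin.sum_univ_succ]
    rfl
  simp only [freqOp, hp]
  rw [binom_affine N hN, Fin.sum_univ_castSucc (fun i => nuW m μ i * x i), nuW_zero m μ hμ1,
    nuW_last, Fin.sum_univ_castSucc (fun i => μ i * x i)]
  simp only [nuW_castSucc, add_mul, Finset.sum_add_distrib, div_mul_eq_mul_div,
    ← Finset.sum_div]
  ring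

/-- The stationarity-weighted total frequency `∑_i ν(i)·x_i` is
conserved in expectation by the seed bank frequency process: for all `g ≥ 0`,
`E_{x̄}[∑_i ν(i)·X_g^{(i)}] = ∑_i ν(i)·x_i`. The expectation of a function of the chain
at time `g` is encoded as the `g`-fold iterate of the transition operator. -/
theorem weighted_frequency_conserved_in_expectation
    (N m : ℕ) (hN : 1 ≤ N) (μ : Fin (m + 1) → ℝ)
    (hμ0 : ∀ i, 0 ≤ μ i) (hμ1 : ∑ i, μ i = 1)
    (x : Fin (m + 1) → ℝ) (hx : ∀ i, ∃ k : ℕ, k ≤ N ∧ x i = (k : ℝ) / N) (g : ℕ) :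
    (freqOp N m μ)^[g] (fun y => ∑ i, nuW m μ i * y i) x
      = ∑ i, nuW m μ i * x i := by
  rw [Function.iterate_fixed (freqOp_fixed N m hN μ hμ1)]
end
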